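/- Let T = {1,2,3,4}, p = (1,1,1,1) and q = (0,1,−1,−1). Then for every perfect matching with parity M on T, the product Π_{(st,σ) ∈ M} [p,q]_{st,σ} equals 2 if M ∈ {{(12,odd),(34,odd)}, {(12,even),(34,odd)}}, equals −2 if M ∈ {{(12,odd),(34,even)}, {(12,even),(34,even)}}, and equals 0 otherwise. Consequently, a PMP M on T satisfies Π_{(st,σ) ∈ M} [p,q]_{st,σ} ≢ 0 (mod 4) if and only if M pairs 1 with 2 and 3 with 4; that is, the set 𝓜₂ := {{(12,σ₁),(34,σ₂)} : σ₁,σ₂ ∈ {odd,even}} is h-representable with N = 1, k = 2, n₁ = 1, p¹ = p, q¹ = q. -/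

import Mathlib

/-- A parity: `odd` or `even`. -/
inductive Par : Type
  | odd : Par
  | even : Par
deriving DecidableEq

/-- The bracket `[p,q]_{st,σ}`: for a parity `σ` and an unordered pair `{s,t}`,
`[p,q]_{st,odd} = p_s p_t + q_s q_t` and `[p,q]_{st,even} = p_s q_t + q_s p_t`. -/
def brkt {n : ℕ} (p q : Fin n → ℤ) (σ : Par) : Sym2 (Fin n) → ℤ :=
  Sym2.lift ⟨fun s t =>
    match σ with
    | Par.odd => p s * p t + q s * q t
    | Par.even => p s * q t + q s * p t,
    by intro a b; cases σ <;> dsimp only <;> ring⟩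

/-- A perfect matching with parity (PMP) on `{0, …, n−1}`: a set of pairs
`(st, σ)` where the unordered pairs `st` are non-degenerate and partition the
index set, and `σ` is a parity. -/
def IsPMP {n : ℕ} (M : Finset (Sym2 (Fin n) × Par)) : Prop :=
  (∀ x ∈ M, ¬ x.1.IsDiag) ∧ ∀ i : Fin n, ∃! x, x ∈ M ∧ i ∈ x.1

/-- The product `Π_{(st,σ) ∈ M} [p,q]_{st,σ}`. -/
def pmpProd {n : ℕ} (p q : Fin n → ℤ) (M : Finset (Sym2 (Fin n) × Par)) : ℤ :=
  ∏ x ∈ M, brkt p q x.2 x.1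

/-- In a PMP, two members sharing an index coincide. -/
theorem IsPMP.eq_of_mem {n : ℕ} {M : Finset (Sym2 (Fin n) × Par)} (hM : IsPMP M)
    {x y : Sym2 (Fin n) × Par} (hx : x ∈ M) (hy : y ∈ M) {i : Fin n}
    (hix : i ∈ x.1) (hiy : i ∈ y.1) : x = y :=
  (hM.2 i).unique ⟨hx, hix⟩ ⟨hy, hiy⟩

/-- Every index of a PMP is matched to some other index. -/
theorem IsPMP.exists_partner {n : ℕ} {M : Finset (Sym2 (Fin n) × Par)} (hM : IsPMP M)
    (i : Fin n) : ∃ j σ, j ≠ i ∧ (s(i, j), σ) ∈ M := by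
  obtain ⟨⟨e, σ⟩, ⟨hx, hi⟩, -⟩ := hM.2 i
  obtain ⟨j, rfl⟩ := Sym2.mem_iff_exists.1 hi
  exact ⟨j, σ, fun h => hM.1 _ hx (by simp [h]), hx⟩

/-- A PMP on an index set `{i, j, k, l}` that pairs `i` with `j` pairs `k` with `l`. -/
theorem IsPMP.eq_pair {n : ℕ} {M : Finset (Sym2 (Fin n) × Par)} (hM : IsPMP M)
    {i j k l : Fin n} (hcover : ∀ a, a = i ∨ a = j ∨ a = k ∨ a = l)
    (hki : k ≠ i) (hkj : k ≠ j) {σ : Par} (hij : (s(i, j), σ) ∈ M) :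
    ∃ τ, M = {(s(i, j), σ), (s(k, l), τ)} := by
  obtain ⟨m, τ, hmk, hkm⟩ := hM.exists_partner k
  have hdisj : ∀ a ∈ s(i, j), a ∉ s(k, m) := fun a ha ha' => by
    have hpair : s(i, j) = s(k, m) := congrArg Prod.fst (hM.eq_of_mem hij hkm ha ha')
    have hk : k ∈ s(i, j) := hpair ▸ Sym2.mem_mk_left k m
    simp [hki, hkj] at hk
  obtain rfl : m = l := by
    rcases hcover m with rfl | rfl | rfl | rfl
    · exact absurd (Sym2.mem_mk_right k m) (hdisj m (Sym2.mem_mk_left m j))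
    · exact absurd (Sym2.mem_mk_right k m) (hdisj m (Sym2.mem_mk_right i m))
    · exact absurd rfl hmk
    · rfl
  refine ⟨τ, Finset.Subset.antisymm (fun y hy => ?_) ?_⟩
  · obtain ⟨a, ha⟩ : ∃ a, a ∈ y.1 := ⟨_, Sym2.out_fst_mem y.1⟩
    rw [Finset.mem_insert, Finset.mem_singleton]
    rcases hcover a with rfl | rfl | rfl | rfl
    · exact .inl (hM.eq_of_mem hy hij ha (Sym2.mem_mk_left _ _))
    · exact .inl (hM.eq_of_mem hy hij ha (Sym2.mem_mk_right _ _))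
    · exact .inr (hM.eq_of_mem hy hkm ha (Sym2.mem_mk_left _ _))
    · exact .inr (hM.eq_of_mem hy hkm ha (Sym2.mem_mk_right _ _))
  · simp [Finset.insert_subset_iff, hij, hkm]

/-- The three perfect matchings of a four-element set, with arbitrary parities. -/
theorem IsPMP.eq_of_four {M : Finset (Sym2 (Fin 4) × Par)} (hM : IsPMP M) :
    ∃ σ τ, M = {(s(0, 1), σ), (s(2, 3), τ)} ∨ M = {(s(0, 2), σ), (s(1, 3), τ)} ∨
      M = {(s(0, 3), σ), (s(1, 2), τ)} := by
  obtain ⟨j, σ, hj, hmem⟩ := hM.exists_partner 0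
  refine ⟨σ, ?_⟩
  fin_cases j
  · exact absurd rfl hj
  · exact (hM.eq_pair (k := 2) (l := 3) (by decide) (by decide) (by decide) hmem).imp
      fun _ h => .inl h
  · exact (hM.eq_pair (k := 1) (l := 3) (by decide) (by decide) (by decide) hmem).imp
      fun _ h => .inr (.inl h)
  · exact (hM.eq_pair (k := 1) (l := 2) (by decide) (by decide) (by decide) hmem).imp
      fun _ h => .inr (.inr h)

/-- For `T = {1,2,3,4}` (encoded as `Fin 4`), `p = (1,1,1,1)` and
`q = (0,1,−1,−1)`: for every PMP `M` on `T`, `Π_{(st,σ) ∈ M} [p,q]_{st,σ}` equals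
`2` if `M ∈ {{(12,odd),(34,odd)}, {(12,even),(34,odd)}}`, equals `−2` if
`M ∈ {{(12,odd),(34,even)}, {(12,even),(34,even)}}`, and equals `0` otherwise.
Consequently the product is `≢ 0 (mod 4)` iff `M` pairs `1` with `2` and `3` with
`4`; that is, `𝓜₂` is h-representable with `N = 1`, `k = 2`, `n₁ = 1`. -/
theorem pmpProd_two_paths (M : Finset (Sym2 (Fin 4) × Par)) (hM : IsPMP M) :
    (pmpProd ![1, 1, 1, 1] ![0, 1, -1, -1] M =
      if M = {(s(0, 1), Par.odd), (s(2, 3), Par.odd)} ∨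
         M = {(s(0, 1), Par.even), (s(2, 3), Par.odd)} then 2
      else if M = {(s(0, 1), Par.odd), (s(2, 3), Par.even)} ∨
              M = {(s(0, 1), Par.even), (s(2, 3), Par.even)} then -2
      else 0) ∧
    (¬ (4 : ℤ) ∣ pmpProd ![1, 1, 1, 1] ![0, 1, -1, -1] M ↔
      ∃ σ₁ σ₂ : Par, M = {(s(0, 1), σ₁), (s(2, 3), σ₂)}) := by
  obtain ⟨σ, τ, rfl | rfl | rfl⟩ := hM.eq_of_four
  · refine ⟨?_, iff_of_true ?_ ⟨σ, τ, rfl⟩⟩ <;> cases σ <;> cases τ <;> decide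
  all_goals
    refine ⟨?_, iff_of_false ?_ ?_⟩
    · cases σ <;> cases τ <;> decide
    · cases σ <;> cases τ <;> decide
    · rintro ⟨σ', τ', h⟩
      cases σ <;> cases τ <;> cases σ' <;> cases τ' <;> revert h <;> decide
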